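/- arXiv:2211.16459 — 4 statements merged into one kernel-verified Lean document; each statement's English description precedes it below -/
import Mathlib

section
/- For every set of triplets T on [n] and every hierarchy H on [n], the triplet revenue equals the negative Dasgupta cost of H with respect to the AddS3 similarity computed from T: Trev(H,T) = − Dcost(H, s^{AddS3}). -/
open Finset MeasureTheory

namespace CompHC

/-- A rooted binary tree with leaves labelled by elements of `Fin n`. -/
inductive HTree (n : ℕ) : Type
  | leaf (i : Fin n) : HTree n
  | node (l r : HTree n) : HTree n

namespace HTree

/-- The list of leaf labels of a tree. -/
def leaves {n : ℕ} : HTree n → List (Fin n)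
  | .leaf i => [i]
  | .node l r => l.leaves ++ r.leaves

/-- The number of leaves of a tree. -/
def size {n : ℕ} (t : HTree n) : ℕ := t.leaves.length

/-- `|H(i ∨ j)|`: the number of leaves of the smallest subtree containing both `i` and `j`. -/
def lcaSize {n : ℕ} : HTree n → Fin n → Fin n → ℕ
  | .leaf _, _, _ => 1
  | .node l r, i, j =>
      if i ∈ l.leaves ∧ j ∈ l.leaves then l.lcaSize i j
      else if i ∈ r.leaves ∧ j ∈ r.leaves then r.lcaSize i j
      else l.size + r.size

/-- Sum of `f |N1| |N2|` over the internal nodes `N` of the tree, `N1, N2` its children. -/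
def internalSum {n : ℕ} (f : ℕ → ℕ → ℕ) : HTree n → ℕ
  | .leaf _ => 0
  | .node l r => f l.size r.size + l.internalSum f + r.internalSum f

end HTree

/-- A hierarchy on `[n]`: every object appears exactly once as a leaf. -/
def IsHierarchy {n : ℕ} (t : HTree n) : Prop :=
  t.leaves.Nodup ∧ ∀ i : Fin n, i ∈ t.leaves

abbrev Triplet (n : ℕ) := Fin n × Fin n × Fin n
abbrev Quadruplet (n : ℕ) := Fin n × Fin n × Fin n × Fin n

/-- The entries of a triplet are pairwise distinct. -/
def distinctTriplet {n : ℕ} (t : Triplet n) : Prop :=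
  t.1 ≠ t.2.1 ∧ t.1 ≠ t.2.2 ∧ t.2.1 ≠ t.2.2

/-- A quadruplet `(i,j,k,l)` satisfies `i<j`, `k<l`, `(i,j) ≠ (k,l)`. -/
def validQuadruplet {n : ℕ} (q : Quadruplet n) : Prop :=
  q.1 < q.2.1 ∧ q.2.2.1 < q.2.2.2 ∧ (q.1, q.2.1) ≠ (q.2.2.1, q.2.2.2)

/-- Triplet revenue `Trev(H,T) = Σ_{(i,j,k)∈T} (|H(i∨k)| − |H(i∨j)|)`. -/
def Trev {n : ℕ} (H : HTree n) (T : Finset (Triplet n)) : ℤ :=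
  ∑ t ∈ T, ((H.lcaSize t.1 t.2.2 : ℤ) - (H.lcaSize t.1 t.2.1 : ℤ))

/-- Quadruplet revenue `Qrev(H,Q) = Σ_{(i,j,k,l)∈Q} (|H(k∨l)| − |H(i∨j)|)`. -/
def Qrev {n : ℕ} (H : HTree n) (Q : Finset (Quadruplet n)) : ℤ :=
  ∑ q ∈ Q, ((H.lcaSize q.2.2.1 q.2.2.2 : ℤ) - (H.lcaSize q.1 q.2.1 : ℤ))

/-- The set of pairs `(i,j)` with `i < j`. -/
def pairs (n : ℕ) : Finset (Fin n × Fin n) :=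
  Finset.univ.filter fun p => p.1 < p.2

/-- Dasgupta's cost `Dcost(H,s) = Σ_{i<j} s_{ij}·|H(i∨j)|`. -/
noncomputable def Dcost {n : ℕ} (H : HTree n) (s : Fin n → Fin n → ℝ) : ℝ :=
  ∑ p ∈ pairs n, s p.1 p.2 * (H.lcaSize p.1 p.2 : ℝ)

/-- The AddS3 similarity computed from a triplet set. -/
def sAddS3 {n : ℕ} (T : Finset (Triplet n)) (i j : Fin n) : ℤ :=
  ∑ k ∈ Finset.univ.filter (fun k : Fin n => k ≠ i ∧ k ≠ j),
    (((if (i, j, k) ∈ T then 1 else 0) - (if (i, k, j) ∈ T then 1 else 0)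
      + (if (j, i, k) ∈ T then 1 else 0) - (if (j, k, i) ∈ T then 1 else 0) : ℤ))

/-- The AddS4 similarity computed from a quadruplet set. -/
def sAddS4 {n : ℕ} (Q : Finset (Quadruplet n)) (i j : Fin n) : ℤ :=
  ∑ p ∈ (pairs n).filter (fun p => p ≠ (i, j)),
    (((if (i, j, p.1, p.2) ∈ Q then 1 else 0)
      - (if (p.1, p.2, i, j) ∈ Q then 1 else 0) : ℤ))

/-- The triplet set induced by a hierarchy `H0`:
`T0 = {(i,j,k) : i,j,k pairwise distinct, |H0(i∨j)| < min(|H0(i∨k)|, |H0(j∨k)|)}`. -/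
def inducedTriplets {n : ℕ} (H : HTree n) : Finset (Triplet n) :=
  Finset.univ.filter fun t : Triplet n =>
    t.1 ≠ t.2.1 ∧ t.1 ≠ t.2.2 ∧ t.2.1 ≠ t.2.2 ∧
    H.lcaSize t.1 t.2.1 < min (H.lcaSize t.1 t.2.2) (H.lcaSize t.2.1 t.2.2)


theorem HTree.lcaSize_comm {n : ℕ} (H : HTree n) (i j : Fin n) :
    H.lcaSize i j = H.lcaSize j i := by
  induction H with
  | leaf a => rfl
  | node l r hl hr =>
    simp only [HTree.lcaSize, hl, hr, and_comm]

/-- A sum over all ordered pairs that vanishes on the diagonal is a sum over pairs `i < j`. -/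
theorem sum_pairs_add_swap {n : ℕ} (f : Fin n → Fin n → ℤ) (hf : ∀ i, f i i = 0) :
    ∑ p ∈ pairs n, (f p.1 p.2 + f p.2 p.1) = ∑ i, ∑ j, f i j := by
  have hswap : ∑ p ∈ pairs n, f p.2 p.1 = ∑ i, ∑ j, if j < i then f i j else 0 := by
    rw [pairs, Finset.sum_filter, Fintype.sum_prod_type, Finset.sum_comm]
  have hlt : ∑ p ∈ pairs n, f p.1 p.2 = ∑ i, ∑ j, if i < j then f i j else 0 := by
    rw [pairs, Finset.sum_filter, Fintype.sum_prod_type]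
  rw [Finset.sum_add_distrib, hswap, hlt, ← Finset.sum_add_distrib]
  refine Finset.sum_congr rfl fun i _ => ?_
  rw [← Finset.sum_add_distrib]
  refine Finset.sum_congr rfl fun j _ => ?_
  rcases lt_trichotomy i j with h | rfl | h
  · simp [h, h.not_gt]
  · simp [hf]
  · simp [h, h.not_gt]

/-- The contribution to the AddS3 similarity of the triplets anchored at `i`. -/
def anchoredAddS3 {n : ℕ} (T : Finset (Triplet n)) (i j : Fin n) : ℤ :=
  ∑ k, ((if (i, j, k) ∈ T then 1 else 0) - (if (i, k, j) ∈ T then 1 else 0))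

theorem anchoredAddS3_self {n : ℕ} {T : Finset (Triplet n)}
    (hT : ∀ t ∈ T, distinctTriplet t) (i : Fin n) : anchoredAddS3 T i i = 0 := by
  refine Finset.sum_eq_zero fun k _ => ?_
  have h1 : (i, i, k) ∉ T := fun h => (hT _ h).1 rfl
  have h2 : (i, k, i) ∉ T := fun h => (hT _ h).2.1 rfl
  simp [h1, h2]

theorem sAddS3_eq_anchoredAddS3_add {n : ℕ} {T : Finset (Triplet n)}
    (hT : ∀ t ∈ T, distinctTriplet t) (i j : Fin n) :
    sAddS3 T i j = anchoredAddS3 T i j + anchoredAddS3 T j i := by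
  rw [sAddS3, anchoredAddS3, anchoredAddS3, ← Finset.sum_add_distrib, Finset.sum_filter]
  refine Finset.sum_congr rfl fun k _ => ?_
  have h1 : ∀ a b, (a, a, b) ∉ T := fun a b h => (hT _ h).1 rfl
  have h2 : ∀ a b, (a, b, a) ∉ T := fun a b h => (hT _ h).2.1 rfl
  have h3 : ∀ a b, (a, b, b) ∉ T := fun a b h => (hT _ h).2.2 rfl
  by_cases h : k ≠ i ∧ k ≠ j
  · rw [if_pos h]
    ring
  · grind

/-- Summing the anchored similarities against any weight recovers a sum over triplets. -/
theorem sum_anchoredAddS3_mul {n : ℕ} (T : Finset (Triplet n)) (w : Fin n → Fin n → ℤ) :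
    ∑ i, ∑ j, anchoredAddS3 T i j * w i j = ∑ t ∈ T, (w t.1 t.2.1 - w t.1 t.2.2) := by
  have hT : ∑ t ∈ T, (w t.1 t.2.1 - w t.1 t.2.2) =
      ∑ i, ∑ j, ∑ k, if (i, j, k) ∈ T then w i j - w i k else 0 := by
    rw [← Finset.univ_inter T, ← Finset.sum_ite_mem, Fintype.sum_prod_type]
    simp only [Fintype.sum_prod_type, Finset.univ_inter]
  rw [hT]
  refine Finset.sum_congr rfl fun i _ => ?_
  have hswap : ∑ j, ∑ k, (if (i, k, j) ∈ T then w i j else 0) =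
      ∑ j, ∑ k, if (i, j, k) ∈ T then w i k else 0 := Finset.sum_comm
  calc ∑ j, anchoredAddS3 T i j * w i j
      = ∑ j, ∑ k, (if (i, j, k) ∈ T then w i j else 0) -
          ∑ j, ∑ k, (if (i, k, j) ∈ T then w i j else 0) := by
        simp only [anchoredAddS3, Finset.sum_mul, ← Finset.sum_sub_distrib, sub_mul, ite_mul,
          one_mul, zero_mul]
    _ = ∑ j, ∑ k, if (i, j, k) ∈ T then w i j - w i k else 0 := by
        rw [hswap]
        simp only [← Finset.sum_sub_distrib]
        refine Finset.sum_congr rfl fun j _ => Finset.sum_congr rfl fun k _ => ?_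
        split_ifs <;> simp

/-- For every triplet set `T` on `[n]` and every hierarchy `H` on `[n]`,
`Trev(H,T) = − Dcost(H, s^{AddS3})`. -/
theorem triplet_revenue_eq_neg_Dcost {n : ℕ} (T : Finset (Triplet n))
    (hT : ∀ t ∈ T, distinctTriplet t) (H : HTree n) (hH : IsHierarchy H) :
    (Trev H T : ℝ) = - Dcost H (fun i j => (sAddS3 T i j : ℝ)) := by
  have key : Trev H T = -∑ p ∈ pairs n, sAddS3 T p.1 p.2 * (H.lcaSize p.1 p.2 : ℤ) := by
    have hpairs := sum_pairs_add_swap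
      (fun i j => anchoredAddS3 T i j * (H.lcaSize i j : ℤ))
      (fun i => by simp [anchoredAddS3_self hT])
    rw [sum_anchoredAddS3_mul T fun i j => (H.lcaSize i j : ℤ)] at hpairs
    have hsym : ∑ p ∈ pairs n, sAddS3 T p.1 p.2 * (H.lcaSize p.1 p.2 : ℤ) =
        ∑ t ∈ T, ((H.lcaSize t.1 t.2.1 : ℤ) - (H.lcaSize t.1 t.2.2 : ℤ)) := by
      rw [← hpairs]
      refine Finset.sum_congr rfl fun p _ => ?_
      rw [sAddS3_eq_anchoredAddS3_add hT, H.lcaSize_comm p.2 p.1, add_mul]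
    rw [hsym, ← Finset.sum_neg_distrib, Trev]
    exact Finset.sum_congr rfl fun t _ => (neg_sub _ _).symm
  rw [key, Dcost]
  push_cast
  rfl

end CompHC
end

section
/- For every set of quadruplets Q on [n] and every hierarchy H on [n], the quadruplet revenue equals the negative Dasgupta cost of H with respect to the AddS4 similarity computed from Q: Qrev(H,Q) = − Dcost(H, s^{AddS4}). -/
open Finset MeasureTheory

namespace CompHC

/-- A sum over a quadruplet set is a double sum over all ordered pairs, weighted by membership. -/
theorem sum_quadruplets_eq_sum_sum {n : ℕ} (Q : Finset (Quadruplet n))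
    (f : Fin n × Fin n → Fin n × Fin n → ℤ) :
    ∑ q ∈ Q, f (q.1, q.2.1) q.2.2 =
      ∑ p : Fin n × Fin n, ∑ p' : Fin n × Fin n,
        (if (p.1, p.2, p'.1, p'.2) ∈ Q then 1 else 0) * f p p' := by
  simp only [Fintype.sum_prod_type, ite_mul, one_mul, zero_mul]
  rw [← Finset.univ_inter Q, ← Finset.sum_ite_mem]
  simp only [Fintype.sum_prod_type, Finset.univ_inter]

/-- For valid quadruplets, the AddS4 similarity may be summed over all ordered pairs. -/
theorem sAddS4_eq_sum_univ {n : ℕ} {Q : Finset (Quadruplet n)}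
    (hQ : ∀ q ∈ Q, validQuadruplet q) (i j : Fin n) :
    sAddS4 Q i j = ∑ p : Fin n × Fin n,
      (((if (i, j, p.1, p.2) ∈ Q then 1 else 0)
        - (if (p.1, p.2, i, j) ∈ Q then 1 else 0) : ℤ)) := by
  refine Finset.sum_subset (Finset.subset_univ _) fun p _ hp => ?_
  have h₁ : (i, j, p.1, p.2) ∉ Q := fun h => hp <| by
    obtain ⟨-, h₂, h₃⟩ := hQ _ h
    simpa [pairs] using And.intro h₂ h₃.symm
  have h₂ : (p.1, p.2, i, j) ∉ Q := fun h => hp <| by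
    obtain ⟨h₂, -, h₃⟩ := hQ _ h
    simpa [pairs] using And.intro h₂ h₃
  simp [h₁, h₂]

theorem sAddS4_eq_zero_of_not_lt {n : ℕ} {Q : Finset (Quadruplet n)}
    (hQ : ∀ q ∈ Q, validQuadruplet q) {i j : Fin n} (hij : ¬ i < j) : sAddS4 Q i j = 0 := by
  refine Finset.sum_eq_zero fun p _ => ?_
  have h₁ : (i, j, p.1, p.2) ∉ Q := fun h => hij (hQ _ h).1
  have h₂ : (p.1, p.2, i, j) ∉ Q := fun h => hij (hQ _ h).2.1
  simp [h₁, h₂]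

/-- The quadruplet identity holds for an arbitrary weight on pairs in place of `|H(i∨j)|`. -/
theorem sum_quadruplets_sub_eq_neg_sum_sAddS4 {n : ℕ} {Q : Finset (Quadruplet n)}
    (hQ : ∀ q ∈ Q, validQuadruplet q) (w : Fin n × Fin n → ℤ) :
    ∑ q ∈ Q, (w q.2.2 - w (q.1, q.2.1)) = -∑ p ∈ pairs n, sAddS4 Q p.1 p.2 * w p := by
  have hpairs : ∑ p ∈ pairs n, sAddS4 Q p.1 p.2 * w p =
      ∑ p : Fin n × Fin n, sAddS4 Q p.1 p.2 * w p := by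
    refine Finset.sum_subset (Finset.subset_univ _) fun p _ hp => ?_
    rw [sAddS4_eq_zero_of_not_lt hQ (by simpa [pairs] using hp), zero_mul]
  rw [hpairs, Finset.sum_sub_distrib, sum_quadruplets_eq_sum_sum Q fun _ p' => w p',
    sum_quadruplets_eq_sum_sum Q fun p _ => w p, Finset.sum_comm]
  simp only [sAddS4_eq_sum_univ hQ, Finset.sum_mul, sub_mul, Finset.sum_sub_distrib, neg_sub]

/-- For every quadruplet set `Q` on `[n]` and every hierarchy `H` on `[n]`,
`Qrev(H,Q) = − Dcost(H, s^{AddS4})`. -/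
theorem quadruplet_revenue_eq_neg_Dcost {n : ℕ} (Q : Finset (Quadruplet n))
    (hQ : ∀ q ∈ Q, validQuadruplet q) (H : HTree n) (hH : IsHierarchy H) :
    (Qrev H Q : ℝ) = - Dcost H (fun i j => (sAddS4 Q i j : ℝ)) := by
  have h := sum_quadruplets_sub_eq_neg_sum_sAddS4 hQ fun p => (H.lcaSize p.1 p.2 : ℤ)
  simp only [Qrev, Dcost]
  rw [h]
  push_cast
  rfl

end CompHC
end

section
/- Let H0 be a hierarchy on [n] and T0 the triplet set induced by H0. Then the AddS3 similarity computed from T0 satisfies, for every pair of distinct objects i,j: s^{AddS3}_{ij} = 2n + 2 − 3·|H0(i∨j)|. -/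
open Finset MeasureTheory

namespace CompHC

namespace HTree

theorem one_le_size {n : ℕ} (t : HTree n) : 1 ≤ t.size := by
  induction t with
  | leaf i => simp [size, leaves]
  | node l r ihl ihr =>
    simp only [size, leaves, List.length_append] at *
    omega

theorem lcaSize_le_size {n : ℕ} (t : HTree n) (i j : Fin n) : t.lcaSize i j ≤ t.size := by
  induction t with
  | leaf i => simp [size, leaves, lcaSize]
  | node l r ihl ihr =>
    simp only [size, leaves, lcaSize, List.length_append] at *
    split_ifs <;> omega

theorem lcaSize_comm_s4 {n : ℕ} (t : HTree n) (i j : Fin n) : t.lcaSize i j = t.lcaSize j i := by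
  induction t with
  | leaf i => rfl
  | node l r ihl ihr => simp only [lcaSize, ihl, ihr, and_comm]

theorem lcaSize_self {n : ℕ} {t : HTree n} {i : Fin n} (hi : i ∈ t.leaves) :
    t.lcaSize i i = 1 := by
  induction t with
  | leaf i => rfl
  | node l r ihl ihr =>
    simp only [leaves, lcaSize, List.mem_append] at *
    grind

theorem one_le_lcaSize {n : ℕ} (t : HTree n) (i j : Fin n) : 1 ≤ t.lcaSize i j := by
  induction t with
  | leaf i => rfl
  | node l r ihl ihr =>
    have := l.one_le_size
    simp only [lcaSize]
    split_ifs <;> omega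

/-- Among the three pairwise least common ancestors of three leaves that are not all equal,
two have the same size and the third one is strictly smaller. -/
theorem lcaSize_trichotomy {n : ℕ} {t : HTree n} (ht : t.leaves.Nodup) {i j k : Fin n}
    (hi : i ∈ t.leaves) (hj : j ∈ t.leaves) (hk : k ∈ t.leaves)
    (hij : i ≠ j) :
    (t.lcaSize i j < t.lcaSize i k ∧ t.lcaSize i k = t.lcaSize j k) ∨
    (t.lcaSize i k < t.lcaSize i j ∧ t.lcaSize i j = t.lcaSize j k) ∨
    (t.lcaSize j k < t.lcaSize i j ∧ t.lcaSize i j = t.lcaSize i k) := by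
  induction t with
  | leaf a => simp_all [leaves]
  | node l r ihl ihr =>
    have hl := l.one_le_size
    have hr := r.one_le_size
    have bl := l.lcaSize_le_size
    have br := r.lcaSize_le_size
    simp only [leaves, List.nodup_append, List.mem_append] at ht hi hj hk
    obtain ⟨hnl, hnr, hd⟩ := ht
    have hd' : ∀ a ∈ l.leaves, a ∉ r.leaves := fun a ha hb => hd a ha a hb rfl
    have hdi := hd' i
    have hdj := hd' j
    have hdk := hd' k
    have b1 := bl i j
    have b2 := bl i k
    have b3 := bl j k
    have b4 := br i j
    have b5 := br i k
    have b6 := br j k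
    clear hd hd' bl br
    simp only [lcaSize]
    rcases hi with hi | hi <;> rcases hj with hj | hj <;> rcases hk with hk | hk <;>
      simp_all <;> omega

theorem countP_lcaSize_le {n : ℕ} {t : HTree n} (ht : t.leaves.Nodup) {i j : Fin n}
    (hi : i ∈ t.leaves) (hj : j ∈ t.leaves) :
    t.leaves.countP (fun k => t.lcaSize i k ≤ t.lcaSize i j) = t.lcaSize i j := by
  induction t with
  | leaf a => simp [leaves, lcaSize]
  | node l r ihl ihr =>
    have hl := l.one_le_size
    have hr := r.one_le_size
    have bl := l.lcaSize_le_size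
    have br := r.lcaSize_le_size
    simp only [leaves, List.nodup_append, List.mem_append] at ht hi hj
    obtain ⟨hnl, hnr, hd⟩ := ht
    have hd' : ∀ a ∈ l.leaves, a ∉ r.leaves := fun a ha hb => hd a ha a hb rfl
    have hle : ∀ k, (node l r).lcaSize i k ≤ l.size + r.size := by
      intro k
      simpa [size, leaves] using (node l r).lcaSize_le_size i k
    rw [leaves, List.countP_append]
    by_cases hL : i ∈ l.leaves ∧ j ∈ l.leaves
    · have e : (node l r).lcaSize i j = l.lcaSize i j := by simp [lcaSize, hL]
      rw [e, List.countP_congr (q := fun k => l.lcaSize i k ≤ l.lcaSize i j) (l := l.leaves),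
        ihl hnl hL.1 hL.2, List.countP_eq_zero.2, add_zero]
      · intro k hk
        have := bl i j
        have : (node l r).lcaSize i k = l.size + r.size := by
          simp only [lcaSize]
          grind
        simp; omega
      · intro k hk
        simp [lcaSize, hL.1, hk]
    by_cases hR : i ∈ r.leaves ∧ j ∈ r.leaves
    · have hil : i ∉ l.leaves := fun h => hd' i h hR.1
      have e : (node l r).lcaSize i j = r.lcaSize i j := by simp [lcaSize, hil, hR]
      rw [e, List.countP_congr (q := fun k => r.lcaSize i k ≤ r.lcaSize i j) (l := r.leaves),
        ihr hnr hR.1 hR.2, List.countP_eq_zero.2, zero_add]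
      · intro k hk
        have := br i j
        have : (node l r).lcaSize i k = l.size + r.size := by
          simp only [lcaSize]
          grind
        simp; omega
      · intro k hk
        simp [lcaSize, hil, hR.1, hk]
    have e : (node l r).lcaSize i j = l.size + r.size := by simp only [lcaSize, hL, hR, if_false]
    rw [e, List.countP_eq_length.2, List.countP_eq_length.2, size, size]
    · intro k _
      simpa using hle k
    · intro k _
      simpa using hle k

end HTree

theorem card_lcaSize_le {n : ℕ} {H : HTree n} (hH : IsHierarchy H) (i j : Fin n) :
    #{k : Fin n | H.lcaSize i k ≤ H.lcaSize i j} = H.lcaSize i j := by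
  obtain ⟨hn, hm⟩ := hH
  have hu : ({k : Fin n | H.lcaSize i k ≤ H.lcaSize i j} : Finset (Fin n)) =
      (H.leaves.filter fun k => H.lcaSize i k ≤ H.lcaSize i j).toFinset := by
    ext; simp [hm]
  rw [hu, List.toFinset_card_of_nodup (hn.filter _), ← List.countP_eq_length_filter]
  exact HTree.countP_lcaSize_le hn (hm i) (hm j)

/-- The contribution of a third object `k` to the AddS3 similarity of `i` and `j`. -/
theorem addS3_summand_of_induced {n : ℕ} {H : HTree n} (hH : IsHierarchy H) {i j k : Fin n}
    (hij : i ≠ j) (hki : k ≠ i) (hkj : k ≠ j) :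
    (((if (i, j, k) ∈ inducedTriplets H then 1 else 0)
      - (if (i, k, j) ∈ inducedTriplets H then 1 else 0)
      + (if (j, i, k) ∈ inducedTriplets H then 1 else 0)
      - (if (j, k, i) ∈ inducedTriplets H then 1 else 0) : ℤ))
      = 2 - 3 * (if H.lcaSize i k ≤ H.lcaSize i j then 1 else 0) := by
  have h := HTree.lcaSize_trichotomy hH.1 (hH.2 i) (hH.2 j) (hH.2 k) hij
  simp only [inducedTriplets, mem_filter, mem_univ, true_and, lt_min_iff, ne_eq, hij, hij.symm,
    hki, hki.symm, hkj, hkj.symm, not_false_eq_true, H.lcaSize_comm_s4 j i, H.lcaSize_comm_s4 k i,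
    H.lcaSize_comm_s4 k j]
  split_ifs <;> omega

/-- For the triplet set `T0` induced by a hierarchy `H0`,
`s^{AddS3}_{ij} = 2n + 2 − 3·|H0(i∨j)|` for all distinct `i, j`. -/
theorem sAddS3_of_induced {n : ℕ} (H0 : HTree n) (hH0 : IsHierarchy H0)
    (i j : Fin n) (hij : i ≠ j) :
    sAddS3 (inducedTriplets H0) i j = 2 * (n : ℤ) + 2 - 3 * (H0.lcaSize i j : ℤ) := by
  have hfilter : univ.filter (fun k : Fin n => k ≠ i ∧ k ≠ j) = univ \ {i, j} := by
    ext; simp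
  have hsum : sAddS3 (inducedTriplets H0) i j = ∑ k ∈ univ \ {i, j},
      (2 - 3 * (if H0.lcaSize i k ≤ H0.lcaSize i j then 1 else 0) : ℤ) := by
    rw [sAddS3, hfilter]
    refine sum_congr rfl fun k hk => ?_
    rw [← hfilter, mem_filter] at hk
    exact addS3_summand_of_induced hH0 hij hk.2.1 hk.2.2
  rw [hsum, sum_sdiff_eq_sub (subset_univ _), sum_pair hij, sum_sub_distrib, ← mul_sum,
    sum_boole, card_lcaSize_le hH0, HTree.lcaSize_self (hH0.2 i),
    if_pos (H0.one_le_lcaSize i j), if_pos le_rfl]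
  simp
  ring

end CompHC
end

section
/- For every hierarchy H on n objects (n ≥ 2), Σ_{N} |N1|·|N2|·|N|² ≥ n⁴/4, where the sum ranges over the internal nodes N of H, N1 and N2 denote the two children of N, and |N|, |N1|, |N2| denote the numbers of leaves of the subtrees rooted at N, N1, N2. -/
open Finset MeasureTheory

namespace CompHC

theorem HTree.size_pos {n : ℕ} (t : HTree n) : 0 < t.size := by
  induction t with
  | leaf i => simp [HTree.size, HTree.leaves]
  | node l r ihl ihr => simp only [HTree.size, HTree.leaves, List.length_append] at *; omega

theorem HTree.size_node {n : ℕ} (l r : HTree n) :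
    (HTree.node l r).size = l.size + r.size := by
  simp [HTree.size, HTree.leaves]

theorem pow_four_le_of_split {a b s t : ℕ} (ha : 0 < a) (hb : 0 < b)
    (hs : a ^ 4 ≤ 4 * s + 1) (ht : b ^ 4 ≤ 4 * t + 1) :
    (a + b) ^ 4 ≤ 4 * (a * b * (a + b) ^ 2 + s + t) := by
  have h : 1 ≤ (a * b) ^ 2 := Nat.one_le_pow _ _ (Nat.mul_pos ha hb)
  nlinarith

theorem HTree.size_pow_four_le {n : ℕ} (t : HTree n) :
    t.size ^ 4 ≤ 4 * t.internalSum (fun a b => a * b * (a + b) ^ 2) + 1 := by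
  induction t with
  | leaf i => simp [HTree.size, HTree.leaves]
  | node l r ihl ihr =>
    rw [HTree.size_node]
    exact (pow_four_le_of_split l.size_pos r.size_pos ihl ihr).trans (Nat.le_succ _)

theorem IsHierarchy.size_eq {n : ℕ} {t : HTree n} (ht : IsHierarchy t) : t.size = n := by
  have h : t.leaves.toFinset = Finset.univ := by
    ext i
    simp [ht.2 i]
  rw [HTree.size, ← List.toFinset_card_of_nodup ht.1, h, Finset.card_univ, Fintype.card_fin]

/-- For every hierarchy `H` on `n ≥ 2` objects,
`Σ_N |N1|·|N2|·|N|² ≥ n⁴/4`, the sum ranging over the internal nodes of `H`. -/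
theorem internalSum_lower_bound {n : ℕ} (hn : 2 ≤ n) (H : HTree n) (hH : IsHierarchy H) :
    (n : ℚ) ^ 4 / 4 ≤ (H.internalSum (fun a b => a * b * (a + b) ^ 2) : ℚ) := by
  have hsize := hH.size_eq
  cases H with
  | leaf i =>
    simp only [HTree.size, HTree.leaves, List.length_singleton] at hsize
    omega
  | node l r =>
    rw [HTree.size_node] at hsize
    have h : (l.size + r.size) ^ 4 ≤
        4 * (HTree.node l r).internalSum (fun a b => a * b * (a + b) ^ 2) :=
      pow_four_le_of_split l.size_pos r.size_pos l.size_pow_four_le r.size_pow_four_le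
    rw [hsize] at h
    rw [div_le_iff₀ (by norm_num), mul_comm]
    exact_mod_cast h

end CompHC
end
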